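/- arXiv:1801.00241 — 8 statements merged into one kernel-verified Lean document; each statement's English description precedes it below -/
import Mathlib

section
/- With E(u) = (cosh u)⁴ and G(u) = (sinh u)², the Gauss curvature K(u) = −(1/(2·√(E(u)·G(u)))) · d/du ( G'(u) / √(E(u)·G(u)) ) of the metric E(u) du² + G(u) dv² satisfies K(u) = (sech u)⁴ = 1/(cosh u)⁴ for all u > 0. -/
open Real

/-- Gauss curvature of a metric `E(u) du² + G(u) dv²` in orthogonal coordinates:
`K = -(1/(2√(EG))) d/du (G'/√(EG))`. -/
noncomputable def gaussCurvature (E G : ℝ → ℝ) (u : ℝ) : ℝ :=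
  -(1 / (2 * Real.sqrt (E u * G u))) *
    deriv (fun u : ℝ => deriv G u / Real.sqrt (E u * G u)) u

theorem sqrt_cosh_pow_four_mul_sinh_sq {u : ℝ} (hu : 0 ≤ u) :
    Real.sqrt (Real.cosh u ^ 4 * Real.sinh u ^ 2) = Real.cosh u ^ 2 * Real.sinh u := by
  have hs : 0 ≤ Real.sinh u := Real.sinh_nonneg_iff.mpr hu
  rw [show Real.cosh u ^ 4 * Real.sinh u ^ 2 = (Real.cosh u ^ 2 * Real.sinh u) ^ 2 by ring]
  exact Real.sqrt_sq (by positivity)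

theorem deriv_sinh_sq (u : ℝ) :
    deriv (fun u : ℝ => Real.sinh u ^ 2) u = 2 * Real.sinh u * Real.cosh u := by
  simp

/-- The metric `cosh⁴u du² + sinh²u dv²` has Gauss curvature `K = sech⁴u` for `u > 0`. -/
theorem gauss_curvature_cosh_metric :
    ∀ u : ℝ, 0 < u →
      gaussCurvature (fun u => (Real.cosh u) ^ 4) (fun u => (Real.sinh u) ^ 2) u
        = 1 / (Real.cosh u) ^ 4 := by
  intro u hu
  have hs : Real.sinh u ≠ 0 := (Real.sinh_pos_iff.mpr hu).ne'
  have hc : Real.cosh u ≠ 0 := (Real.cosh_pos u).ne'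
  have hquot : (fun x : ℝ => deriv (fun u : ℝ => Real.sinh u ^ 2) x /
      Real.sqrt (Real.cosh x ^ 4 * Real.sinh x ^ 2)) =ᶠ[nhds u] fun x => 2 / Real.cosh x := by
    filter_upwards [Ioi_mem_nhds hu] with x hx
    have hsx : Real.sinh x ≠ 0 := (Real.sinh_pos_iff.mpr hx).ne'
    have hcx : Real.cosh x ≠ 0 := (Real.cosh_pos x).ne'
    rw [deriv_sinh_sq, sqrt_cosh_pow_four_mul_sinh_sq (le_of_lt hx)]
    field_simp
  have hderiv : deriv (fun x : ℝ => 2 / Real.cosh x) u =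
      (0 * Real.cosh u - 2 * Real.sinh u) / Real.cosh u ^ 2 :=
    ((hasDerivAt_const u (2 : ℝ)).div (Real.hasDerivAt_cosh u) hc).deriv
  simp only [gaussCurvature]
  rw [hquot.deriv_eq, hderiv, sqrt_cosh_pow_four_mul_sinh_sq hu.le]
  field_simp
  ring
end

section
/- Define ψ : ℝ² → ℝ³ by ψ(u,v) = ( sinh u · cos v, sinh u · sin v, (sinh u)²/2 ). Then for all (u,v): (i) the partial derivatives satisfy ⟨∂ψ/∂u, ∂ψ/∂u⟩ₑ = (cosh u)⁴, ⟨∂ψ/∂v, ∂ψ/∂v⟩ₑ = (sinh u)², and ⟨∂ψ/∂u, ∂ψ/∂v⟩ₑ = 0, where ⟨x,y⟩ₑ = x₁y₁ + x₂y₂ + x₃y₃ is the Euclidean inner product on ℝ³; (ii) the third component of ψ(u,v) equals half the sum of the squares of the first two components, i.e. the image of ψ lies on the paraboloid z = (x² + y²)/2. -/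
open Real

/-- The Euclidean inner product on `ℝ³`. -/
def dotE (x y : Fin 3 → ℝ) : ℝ := x 0 * y 0 + x 1 * y 1 + x 2 * y 2

/-- The embedding `ψ(u,v) = (sinh u cos v, sinh u sin v, sinh²u / 2)` realizing the metric
`cosh⁴u du² + sinh²u dv²` as the paraboloid `z = (x² + y²)/2` in Euclidean `ℝ³`. -/
noncomputable def ψpar (u v : ℝ) : Fin 3 → ℝ :=
  ![Real.sinh u * Real.cos v, Real.sinh u * Real.sin v, (Real.sinh u) ^ 2 / 2]

theorem hasDerivAt_ψpar_left (u v : ℝ) :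
    HasDerivAt (fun u => ψpar u v)
      ![cosh u * cos v, cosh u * sin v, sinh u * cosh u] u := by
  rw [hasDerivAt_pi]
  intro i
  fin_cases i
  · exact (hasDerivAt_sinh u).mul_const (cos v)
  · exact (hasDerivAt_sinh u).mul_const (sin v)
  · refine (((hasDerivAt_sinh u).pow 2).div_const 2).congr_deriv ?_
    simp
    ring

theorem hasDerivAt_ψpar_right (u v : ℝ) :
    HasDerivAt (fun v => ψpar u v)
      ![sinh u * -sin v, sinh u * cos v, 0] v := by
  rw [hasDerivAt_pi]
  intro i
  fin_cases i
  · exact (hasDerivAt_cos v).const_mul (sinh u)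
  · exact (hasDerivAt_sin v).const_mul (sinh u)
  · exact hasDerivAt_const v (sinh u ^ 2 / 2)

theorem paraboloid_isometric_embedding :
    ∀ u v : ℝ,
      dotE (deriv (fun u => ψpar u v) u) (deriv (fun u => ψpar u v) u)
          = (Real.cosh u) ^ 4 ∧
      dotE (deriv (fun v => ψpar u v) v) (deriv (fun v => ψpar u v) v)
          = (Real.sinh u) ^ 2 ∧
      dotE (deriv (fun u => ψpar u v) u) (deriv (fun v => ψpar u v) v) = 0 ∧
      ψpar u v 2 = ((ψpar u v 0) ^ 2 + (ψpar u v 1) ^ 2) / 2 := by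
  intro u v
  rw [(hasDerivAt_ψpar_left u v).deriv, (hasDerivAt_ψpar_right u v).deriv]
  have hv := sin_sq_add_cos_sq v
  have hu := cosh_sq u
  simp only [dotE, ψpar, Matrix.cons_val]
  refine ⟨?_, ?_, ?_, ?_⟩
  · linear_combination cosh u ^ 2 * hv - cosh u ^ 2 * hu
  · linear_combination sinh u ^ 2 * hv
  · ring
  · linear_combination -(sinh u ^ 2 / 2) * hv
end

section
/- For a₁ > 0 and a₂, a₃ ∈ ℝ, let g(a₁,a₂,a₃) be the 3×3 real matrix with entries: row 1: ( ((a₂a₃+1)² + a₂² + a₁²(a₃²+1))/(2a₁), ((a₂a₃+1)² + a₂² − a₁²(a₃²+1))/(2a₁), −a₂(a₃²+1) − a₃ ); row 2: ( ((a₂a₃+1)² − a₂² + a₁²(a₃²−1))/(2a₁), ((a₂a₃+1)² − a₂² − a₁²(a₃²−1))/(2a₁), −a₂(a₃²−1) − a₃ ); row 3: ( (−a₃(a₂² + a₁²) − a₂)/a₁, (−a₃(a₂² − a₁²) − a₂)/a₁, 2a₂a₃ + 1 ). Then, with J = diag(1, −1, −1): (i) g(a₁,a₂,a₃)ᵀ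 · J · g(a₁,a₂,a₃) = J; (ii) det g(a₁,a₂,a₃) = 1; (iii) the (1,1) entry of g(a₁,a₂,a₃) is strictly positive. Hence g(a₁,a₂,a₃) lies in the identity component SO(1,2)⁺ of the Lorentz group. -/
open Matrix

/-- The rational parametrization of (an open dense subset of) `SO(1,2)⁺`. -/
noncomputable def gLorentz (a₁ a₂ a₃ : ℝ) : Matrix (Fin 3) (Fin 3) ℝ :=
  !![((a₂*a₃+1)^2 + a₂^2 + a₁^2*(a₃^2+1))/(2*a₁),
     ((a₂*a₃+1)^2 + a₂^2 - a₁^2*(a₃^2+1))/(2*a₁),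
     -(a₂*(a₃^2+1)) - a₃;
     ((a₂*a₃+1)^2 - a₂^2 + a₁^2*(a₃^2-1))/(2*a₁),
     ((a₂*a₃+1)^2 - a₂^2 - a₁^2*(a₃^2-1))/(2*a₁),
     -(a₂*(a₃^2-1)) - a₃;
     (-(a₃*(a₂^2 + a₁^2)) - a₂)/a₁,
     (-(a₃*(a₂^2 - a₁^2)) - a₂)/a₁,
     2*a₂*a₃ + 1]

/-- `g(a₁,a₂,a₃)` preserves the Lorentz form `diag(1,-1,-1)`, has determinant `1`,
and has positive `(1,1)` entry; hence it lies in `SO(1,2)⁺`. -/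
theorem gLorentz_mem_SO12_plus (a₁ a₂ a₃ : ℝ) (ha₁ : 0 < a₁) :
    (gLorentz a₁ a₂ a₃)ᵀ * Matrix.diagonal ![1, -1, -1] * gLorentz a₁ a₂ a₃
        = Matrix.diagonal ![1, -1, -1] ∧
    (gLorentz a₁ a₂ a₃).det = 1 ∧
    0 < gLorentz a₁ a₂ a₃ 0 0 := by
  refine ⟨?_, ?_, ?_⟩
  · ext i j
    fin_cases i <;> fin_cases j <;>
      simp [gLorentz, Matrix.mul_apply, Fin.sum_univ_three, Matrix.diagonal_apply] <;>
      field_simp <;> ring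
  · rw [Matrix.det_fin_three]
    simp only [gLorentz, Matrix.of_apply, Matrix.cons_val]
    field_simp
    ring
  · simp only [gLorentz, Matrix.of_apply, Matrix.cons_val]
    positivity
end

section
/- For real numbers p, p₀, q, q₀ with p ≠ q, p₀ ≠ 0, q₀ ≠ 0, let M be the 3×3 real matrix with rows: row 1: ( −(p₀²(p²+1) + q₀²(q²+1))/(2p₀q₀(p−q)), (pq+1)/(p−q), −(p₀²(p²+1) − q₀²(q²+1))/(2p₀q₀(p−q)) ); row 2: ( −(p₀²(p²−1) + q₀²(q²−1))/(2p₀q₀(p−q)), (pq−1)/(p−q), −(p₀²(p²−1) − q₀²(q²−1))/(2p₀q₀(p−q)) ); row 3: ( (p₀²p + q₀²q)/(p₀q₀(p−q)), −(p+q)/(p−q), (p₀²p − q₀²q)/(p₀q₀(p−q)) ). Then Mᵀ · J · M = J, where J = diag(1, −1, −1); that is, the columns of M form a Lorentz-orthonormal frame for the quadratic form x₁² − x₂² − x₃² on ℝ³. -/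
open Matrix

/-- The Lorentz frame matrix in the coordinates `(p, p₀, q, q₀)` adapted to the
Darboux invariants of the isometric embedding system. -/
noncomputable def framePQ (p p₀ q q₀ : ℝ) : Matrix (Fin 3) (Fin 3) ℝ :=
  !![-(p₀^2*(p^2+1) + q₀^2*(q^2+1))/(2*p₀*q₀*(p-q)),
     (p*q+1)/(p-q),
     -(p₀^2*(p^2+1) - q₀^2*(q^2+1))/(2*p₀*q₀*(p-q));
     -(p₀^2*(p^2-1) + q₀^2*(q^2-1))/(2*p₀*q₀*(p-q)),
     (p*q-1)/(p-q),
     -(p₀^2*(p^2-1) - q₀^2*(q^2-1))/(2*p₀*q₀*(p-q));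
     (p₀^2*p + q₀^2*q)/(p₀*q₀*(p-q)),
     -(p+q)/(p-q),
     (p₀^2*p - q₀^2*q)/(p₀*q₀*(p-q))]

/-- The columns of `framePQ` form a Lorentz-orthonormal frame for `x₁² - x₂² - x₃²`:
`Mᵀ J M = J` with `J = diag(1,-1,-1)`. -/
theorem framePQ_lorentz_orthonormal (p p₀ q q₀ : ℝ)
    (hpq : p ≠ q) (hp₀ : p₀ ≠ 0) (hq₀ : q₀ ≠ 0) :
    (framePQ p p₀ q q₀)ᵀ * Matrix.diagonal ![1, -1, -1] * framePQ p p₀ q q₀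
      = Matrix.diagonal ![1, -1, -1] := by
  have hsub : p - q ≠ 0 := sub_ne_zero.mpr hpq
  ext i j
  fin_cases i <;> fin_cases j <;>
    simp [framePQ, Matrix.mul_apply, Fin.sum_univ_three, Matrix.diagonal_apply] <;>
    field_simp <;> ring
end

section
/- On ℝ⁸ with coordinates (p, p₀, q, q₀, v, x₁, x₂, x₃), define the smooth vector fields X₁ = ∂_{p₀} + ¼p₀q₀²(p−q)(pq+1)·∂_{x₁} + ¼p₀q₀²(p−q)(pq−1)·∂_{x₂} − ¼p₀q₀²(p²−q²)·∂_{x₃}; X₂ = ∂_p − ½p₀²·∂_v − ⅛p₀²(p₀²(p²+1) + q₀²(q² − 2pq − 1))·∂_{x₁} − ⅛p₀²(p₀²(p²−1) + q₀²(q² − 2pq + 1))·∂_{x₂} + ¼p·p₀²(p₀² − q₀²)·∂_{x₃}; Y₁ = ∂_{q₀} + ¼p₀²q₀(p−q)(pq+1)·∂_{x₁} + ¼p₀²q₀(p−q)(pq−1)·∂_{x₂} − ¼p₀²q₀(p²−q²)·∂_{x₃}; Y₂ = ∂_q + ½q₀²·∂_v + ⅛q₀²(p₀²(p² − 2pq −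 1) + q₀²(q²+1))·∂_{x₁} + ⅛q₀²(p₀²(p² − 2pq + 1) + q₀²(q²−1))·∂_{x₂} + ¼q·q₀²(p₀² − q₀²)·∂_{x₃}. Then the Lie brackets satisfy [Xᵢ, Yⱼ] = 0 for all i, j ∈ {1, 2}, where for vector fields X, Y : ℝ⁸ → ℝ⁸ the Lie bracket is [X,Y](z) = (DY)(z)(X(z)) − (DX)(z)(Y(z)) with D the Fréchet derivative. -/
/-! Coordinates on `ℝ⁸ = Fin 8 → ℝ`: `z 0 = p`, `z 1 = p₀`, `z 2 = q`, `z 3 = q₀`,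
`z 4 = v`, `z 5 = x₁`, `z 6 = x₂`, `z 7 = x₃`. -/

noncomputable def X₁ (z : Fin 8 → ℝ) : Fin 8 → ℝ :=
  ![0, 1, 0, 0, 0,
    (1/4) * z 1 * (z 3)^2 * (z 0 - z 2) * (z 0 * z 2 + 1),
    (1/4) * z 1 * (z 3)^2 * (z 0 - z 2) * (z 0 * z 2 - 1),
    -(1/4) * z 1 * (z 3)^2 * ((z 0)^2 - (z 2)^2)]

noncomputable def X₂ (z : Fin 8 → ℝ) : Fin 8 → ℝ :=
  ![1, 0, 0, 0, -(1/2) * (z 1)^2,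
    -(1/8) * (z 1)^2 * ((z 1)^2 * ((z 0)^2 + 1) + (z 3)^2 * ((z 2)^2 - 2 * z 0 * z 2 - 1)),
    -(1/8) * (z 1)^2 * ((z 1)^2 * ((z 0)^2 - 1) + (z 3)^2 * ((z 2)^2 - 2 * z 0 * z 2 + 1)),
    (1/4) * z 0 * (z 1)^2 * ((z 1)^2 - (z 3)^2)]

noncomputable def Y₁ (z : Fin 8 → ℝ) : Fin 8 → ℝ :=
  ![0, 0, 0, 1, 0,
    (1/4) * (z 1)^2 * z 3 * (z 0 - z 2) * (z 0 * z 2 + 1),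
    (1/4) * (z 1)^2 * z 3 * (z 0 - z 2) * (z 0 * z 2 - 1),
    -(1/4) * (z 1)^2 * z 3 * ((z 0)^2 - (z 2)^2)]

noncomputable def Y₂ (z : Fin 8 → ℝ) : Fin 8 → ℝ :=
  ![0, 0, 1, 0, (1/2) * (z 3)^2,
    (1/8) * (z 3)^2 * ((z 1)^2 * ((z 0)^2 - 2 * z 0 * z 2 - 1) + (z 3)^2 * ((z 2)^2 + 1)),
    (1/8) * (z 3)^2 * ((z 1)^2 * ((z 0)^2 - 2 * z 0 * z 2 + 1) + (z 3)^2 * ((z 2)^2 - 1)),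
    (1/4) * z 2 * (z 3)^2 * ((z 1)^2 - (z 3)^2)]

/-- The Lie bracket of vector fields `X, Y : ℝ⁸ → ℝ⁸`:
`[X,Y](z) = DY(z)(X(z)) − DX(z)(Y(z))`. -/
noncomputable def lieBracket (X Y : (Fin 8 → ℝ) → (Fin 8 → ℝ)) (z : Fin 8 → ℝ) :
    Fin 8 → ℝ :=
  fderiv ℝ Y z (X z) - fderiv ℝ X z (Y z)

theorem differentiable_X₁ : Differentiable ℝ X₁ := by
  unfold X₁
  refine differentiable_pi.2 fun i => ?_
  fin_cases i <;> simp <;> fun_prop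

theorem differentiable_X₂ : Differentiable ℝ X₂ := by
  unfold X₂
  refine differentiable_pi.2 fun i => ?_
  fin_cases i <;> simp <;> fun_prop

theorem differentiable_Y₁ : Differentiable ℝ Y₁ := by
  unfold Y₁
  refine differentiable_pi.2 fun i => ?_
  fin_cases i <;> simp <;> fun_prop

theorem differentiable_Y₂ : Differentiable ℝ Y₂ := by
  unfold Y₂
  refine differentiable_pi.2 fun i => ?_
  fin_cases i <;> simp <;> fun_prop

theorem fderiv_apply_eq_deriv_line {F : (Fin 8 → ℝ) → (Fin 8 → ℝ)} (hF : Differentiable ℝ F)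
    (z w : Fin 8 → ℝ) (i : Fin 8) :
    fderiv ℝ F z w i = deriv (fun t : ℝ => F (z + t • w) i) 0 := by
  have h := (hF z).hasFDerivAt.hasLineDerivAt w
  exact (hasDerivAt_pi.1 h i).deriv.symm

/-- Commutation may be checked componentwise along the straight lines directed by the fields. -/
theorem lieBracket_eq_zero_of_deriv_line {X Y : (Fin 8 → ℝ) → (Fin 8 → ℝ)}
    (hX : Differentiable ℝ X) (hY : Differentiable ℝ Y) (z : Fin 8 → ℝ)
    (h : ∀ i, deriv (fun t : ℝ => Y (z + t • X z) i) 0 = deriv (fun t : ℝ => X (z + t • Y z) i) 0) :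
    lieBracket X Y z = 0 := by
  ext i
  simp only [lieBracket, Pi.sub_apply, Pi.zero_apply, fderiv_apply_eq_deriv_line hX,
    fderiv_apply_eq_deriv_line hY, h i, sub_self]

/-- The basis vector fields of the two characteristic distributions commute exactly:
`[Xᵢ, Yⱼ] = 0` for all `i, j ∈ {1,2}`. -/
theorem characteristic_distributions_commute :
    ∀ z : Fin 8 → ℝ,
      lieBracket X₁ Y₁ z = 0 ∧ lieBracket X₁ Y₂ z = 0 ∧
      lieBracket X₂ Y₁ z = 0 ∧ lieBracket X₂ Y₂ z = 0 := by
  intro z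
  refine ⟨?_, ?_, ?_, ?_⟩
  · refine lieBracket_eq_zero_of_deriv_line differentiable_X₁ differentiable_Y₁ z fun i => ?_
    fin_cases i <;>
      simp (disch := fun_prop) [X₁, Y₁, deriv_fun_mul, deriv_fun_add, deriv_fun_sub,
        deriv_fun_pow, -mul_eq_mul_left_iff, -mul_eq_mul_right_iff] <;> ring
  · refine lieBracket_eq_zero_of_deriv_line differentiable_X₁ differentiable_Y₂ z fun i => ?_
    fin_cases i <;>
      simp (disch := fun_prop) [X₁, Y₂, deriv_fun_mul, deriv_fun_add, deriv_fun_sub,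
        deriv_fun_pow, -mul_eq_mul_left_iff, -mul_eq_mul_right_iff] <;> ring
  · refine lieBracket_eq_zero_of_deriv_line differentiable_X₂ differentiable_Y₁ z fun i => ?_
    fin_cases i <;>
      simp (disch := fun_prop) [X₂, Y₁, deriv_fun_mul, deriv_fun_add, deriv_fun_sub,
        deriv_fun_pow, -mul_eq_mul_left_iff, -mul_eq_mul_right_iff] <;> ring
  · refine lieBracket_eq_zero_of_deriv_line differentiable_X₂ differentiable_Y₂ z fun i => ?_
    fin_cases i <;>
      simp (disch := fun_prop) [X₂, Y₂, deriv_fun_mul, deriv_fun_add, deriv_fun_sub,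
        deriv_fun_pow, -mul_eq_mul_left_iff, -mul_eq_mul_right_iff] <;> ring
end

section
/- On ℝ⁸ with coordinates (p, p₀, q, q₀, v, x₁, x₂, x₃), let X₁ = ∂_{p₀} + ¼p₀q₀²(p−q)(pq+1)·∂_{x₁} + ¼p₀q₀²(p−q)(pq−1)·∂_{x₂} − ¼p₀q₀²(p²−q²)·∂_{x₃} and Y₁ = ∂_{q₀} + ¼p₀²q₀(p−q)(pq+1)·∂_{x₁} + ¼p₀²q₀(p−q)(pq−1)·∂_{x₂} − ¼p₀²q₀(p²−q²)·∂_{x₃}. Define the functions y₁ = x₁ − ⅛p₀²q₀²(p−q)(1+pq), y₂ = x₂ + ⅛p₀²q₀²(p−q)(1−pq), y₃ = x₃ + ⅛p₀²q₀²(p² − q²). Then each of the six functions p, q, v, y₁, y₂, y₃ has vanishing directional derivative along both X₁ and Y₁ at every point of ℝ⁸; i.e., they are first integrals of the rank-2 distribution spanned by X₁ and Y₁. -/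
/-- The first integrals `y₁, y₂, y₃` of the distribution spanned by `X₁, Y₁`. -/
noncomputable def y₁ (z : Fin 8 → ℝ) : ℝ :=
  z 5 - (1/8) * (z 1)^2 * (z 3)^2 * (z 0 - z 2) * (1 + z 0 * z 2)

noncomputable def y₂ (z : Fin 8 → ℝ) : ℝ :=
  z 6 + (1/8) * (z 1)^2 * (z 3)^2 * (z 0 - z 2) * (1 - z 0 * z 2)

noncomputable def y₃ (z : Fin 8 → ℝ) : ℝ :=
  z 7 + (1/8) * (z 1)^2 * (z 3)^2 * ((z 0)^2 - (z 2)^2)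

theorem fderiv_coord (i : Fin 8) (z w : Fin 8 → ℝ) :
    fderiv ℝ (fun z : Fin 8 → ℝ => z i) z w = w i := by
  rw [(hasFDerivAt_apply i z).fderiv, ContinuousLinearMap.proj_apply]

theorem fderiv_y₁ (z w : Fin 8 → ℝ) :
    fderiv ℝ y₁ z w = w 5 - (1/8) *
      (2 * z 1 * z 3 * (w 1 * z 3 + z 1 * w 3) * (z 0 - z 2) * (1 + z 0 * z 2)
        + (z 1)^2 * (z 3)^2 * ((w 0 - w 2) * (1 + z 0 * z 2)
          + (z 0 - z 2) * (w 0 * z 2 + z 0 * w 2))) := by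
  have h (i : Fin 8) := hasFDerivAt_apply (𝕜 := ℝ) i z
  have hy := (h 5).fun_sub ((((((h 1).pow 2).const_mul (1/8)).fun_mul ((h 3).pow 2)).fun_mul
    ((h 0).fun_sub (h 2))).fun_mul (((h 0).fun_mul (h 2)).const_add 1))
  rw [HasFDerivAt.fderiv (f := y₁) hy]
  simp
  ring

theorem fderiv_y₂ (z w : Fin 8 → ℝ) :
    fderiv ℝ y₂ z w = w 6 + (1/8) *
      (2 * z 1 * z 3 * (w 1 * z 3 + z 1 * w 3) * (z 0 - z 2) * (1 - z 0 * z 2)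
        + (z 1)^2 * (z 3)^2 * ((w 0 - w 2) * (1 - z 0 * z 2)
          - (z 0 - z 2) * (w 0 * z 2 + z 0 * w 2))) := by
  have h (i : Fin 8) := hasFDerivAt_apply (𝕜 := ℝ) i z
  have hy := (h 6).fun_add ((((((h 1).pow 2).const_mul (1/8)).fun_mul ((h 3).pow 2)).fun_mul
    ((h 0).fun_sub (h 2))).fun_mul (((h 0).fun_mul (h 2)).const_sub 1))
  rw [HasFDerivAt.fderiv (f := y₂) hy]
  simp
  ring

theorem fderiv_y₃ (z w : Fin 8 → ℝ) :
    fderiv ℝ y₃ z w = w 7 + (1/8) *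
      (2 * z 1 * z 3 * (w 1 * z 3 + z 1 * w 3) * ((z 0)^2 - (z 2)^2)
        + 2 * (z 1)^2 * (z 3)^2 * (z 0 * w 0 - z 2 * w 2)) := by
  have h (i : Fin 8) := hasFDerivAt_apply (𝕜 := ℝ) i z
  have hy := (h 7).fun_add (((((h 1).pow 2).const_mul (1/8)).fun_mul ((h 3).pow 2)).fun_mul
    (((h 0).pow 2).fun_sub ((h 2).pow 2)))
  rw [HasFDerivAt.fderiv (f := y₃) hy]
  simp
  ring

/-- The six functions `p, q, v, y₁, y₂, y₃` are first integrals of the rank-2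
distribution spanned by `X₁` and `Y₁`: their directional derivatives along `X₁` and
`Y₁` vanish everywhere. -/
theorem first_integrals_of_B :
    ∀ z : Fin 8 → ℝ,
      (fderiv ℝ (fun z : Fin 8 → ℝ => z 0) z (X₁ z) = 0 ∧
        fderiv ℝ (fun z : Fin 8 → ℝ => z 0) z (Y₁ z) = 0) ∧
      (fderiv ℝ (fun z : Fin 8 → ℝ => z 2) z (X₁ z) = 0 ∧
        fderiv ℝ (fun z : Fin 8 → ℝ => z 2) z (Y₁ z) = 0) ∧
      (fderiv ℝ (fun z : Fin 8 → ℝ => z 4) z (X₁ z) = 0 ∧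
        fderiv ℝ (fun z : Fin 8 → ℝ => z 4) z (Y₁ z) = 0) ∧
      (fderiv ℝ y₁ z (X₁ z) = 0 ∧ fderiv ℝ y₁ z (Y₁ z) = 0) ∧
      (fderiv ℝ y₂ z (X₁ z) = 0 ∧ fderiv ℝ y₂ z (Y₁ z) = 0) ∧
      (fderiv ℝ y₃ z (X₁ z) = 0 ∧ fderiv ℝ y₃ z (Y₁ z) = 0) := by
  intro z
  simp only [fderiv_coord, fderiv_y₁, fderiv_y₂, fderiv_y₃]
  refine ⟨⟨?_, ?_⟩, ⟨?_, ?_⟩, ⟨?_, ?_⟩, ⟨?_, ?_⟩, ⟨?_, ?_⟩, ?_, ?_⟩ <;>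
    simp [X₁, Y₁] <;> ring
end

section
/- Let ε₁, ε₂ ∈ ℝ with ε₁² ≠ ε₂². Define ι : ℝ² → ℝ³ by ι(u,v) = (x₁, x₂, x₃) where x₁ = ((ε₁²+ε₂²)(v³+3u²v) − 2ε₁ε₂(u³+3uv²))/(3(ε₁²−ε₂²)²) + ¼(ε₁²+ε₂²)v − ½ε₁ε₂u; x₂ = ((ε₁²+ε₂²)(v³+3u²v) − 2ε₁ε₂(u³+3uv²))/(3(ε₁²−ε₂²)²) − ¼(ε₁²+ε₂²)v + ½ε₁ε₂u; x₃ = ((ε₁²+ε₂²)(u²+v²) − 4ε₁ε₂uv)/(2(ε₁²−ε₂²)). Then, with the Minkowski pairing ⟨x,y⟩ = x₁y₁ − x₂y₂ − x₃y₃ on ℝ³, for all (u,v) ∈ ℝ²: ⟨∂ι/∂u, ∂ι/∂u⟩ = −u², ⟨∂ι/∂v, ∂ι/∂v⟩ = u², and ⟨∂ι/∂u, ∂ι/∂v⟩ = 0. -/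
/-- The Minkowski pairing `⟨x,y⟩ = x₁y₁ − x₂y₂ − x₃y₃` on `ℝ³`. -/
def mink (x y : Fin 3 → ℝ) : ℝ := x 0 * y 0 - x 1 * y 1 - x 2 * y 2

/-- The explicit polynomial family of isometric immersions of `u²(dv² − du²)` into
Minkowski space, obtained from the superposition formula with cubic data. -/
noncomputable def ιpoly (ε₁ ε₂ : ℝ) (u v : ℝ) : Fin 3 → ℝ :=
  ![((ε₁^2 + ε₂^2) * (v^3 + 3*u^2*v) - 2*ε₁*ε₂*(u^3 + 3*u*v^2)) / (3*(ε₁^2 - ε₂^2)^2)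
      + (1/4)*(ε₁^2 + ε₂^2)*v - (1/2)*ε₁*ε₂*u,
    ((ε₁^2 + ε₂^2) * (v^3 + 3*u^2*v) - 2*ε₁*ε₂*(u^3 + 3*u*v^2)) / (3*(ε₁^2 - ε₂^2)^2)
      - (1/4)*(ε₁^2 + ε₂^2)*v + (1/2)*ε₁*ε₂*u,
    ((ε₁^2 + ε₂^2)*(u^2 + v^2) - 4*ε₁*ε₂*u*v) / (2*(ε₁^2 - ε₂^2))]

theorem hasDerivAt_of_eq_cubic {f : ℝ → ℝ} {f' t : ℝ} (c₀ c₁ c₂ c₃ : ℝ)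
    (hf : ∀ s, f s = c₀ + c₁ * s + c₂ * s^2 + c₃ * s^3)
    (hf' : f' = c₁ + 2 * c₂ * t + 3 * c₃ * t^2) : HasDerivAt f f' t := by
  have h := ((((hasDerivAt_id' t).const_mul c₁).const_add c₀).add
    ((hasDerivAt_pow 2 t).const_mul c₂)).add ((hasDerivAt_pow 3 t).const_mul c₃)
  refine (h.congr_deriv ?_).congr_of_eventuallyEq (.of_forall hf)
  rw [hf']
  norm_num
  ring

theorem hasDerivAt_ιpoly_left (ε₁ ε₂ u v : ℝ) :
    HasDerivAt (fun u => ιpoly ε₁ ε₂ u v)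
      ![(2*(ε₁^2 + ε₂^2)*u*v - 2*ε₁*ε₂*(u^2 + v^2)) / (ε₁^2 - ε₂^2)^2 - (1/2)*ε₁*ε₂,
        (2*(ε₁^2 + ε₂^2)*u*v - 2*ε₁*ε₂*(u^2 + v^2)) / (ε₁^2 - ε₂^2)^2 + (1/2)*ε₁*ε₂,
        ((ε₁^2 + ε₂^2)*u - 2*ε₁*ε₂*v) / (ε₁^2 - ε₂^2)] u := by
  set a := ε₁^2 + ε₂^2 with ha
  set d := ε₁^2 - ε₂^2 with hd
  clear_value a d
  rw [hasDerivAt_pi]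
  intro i
  fin_cases i <;>
    simp only [ιpoly, ← ha, ← hd, Fin.zero_eta, Fin.mk_one, Fin.reduceFinMk, Matrix.cons_val]
  · refine hasDerivAt_of_eq_cubic (a*v^3/(3*d^2) + (1/4)*a*v) (-(2*ε₁*ε₂*v^2)/d^2 - (1/2)*ε₁*ε₂)
      (a*v/d^2) (-(2*ε₁*ε₂)/(3*d^2)) ?_ ?_ <;> intros <;> ring
  · refine hasDerivAt_of_eq_cubic (a*v^3/(3*d^2) - (1/4)*a*v) (-(2*ε₁*ε₂*v^2)/d^2 + (1/2)*ε₁*ε₂)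
      (a*v/d^2) (-(2*ε₁*ε₂)/(3*d^2)) ?_ ?_ <;> intros <;> ring
  · refine hasDerivAt_of_eq_cubic (a*v^2/(2*d)) (-(2*ε₁*ε₂*v)/d) (a/(2*d)) 0 ?_ ?_ <;>
      intros <;> ring

theorem hasDerivAt_ιpoly_right (ε₁ ε₂ u v : ℝ) :
    HasDerivAt (fun v => ιpoly ε₁ ε₂ u v)
      ![((ε₁^2 + ε₂^2)*(u^2 + v^2) - 4*ε₁*ε₂*u*v) / (ε₁^2 - ε₂^2)^2 + (1/4)*(ε₁^2 + ε₂^2),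
        ((ε₁^2 + ε₂^2)*(u^2 + v^2) - 4*ε₁*ε₂*u*v) / (ε₁^2 - ε₂^2)^2 - (1/4)*(ε₁^2 + ε₂^2),
        ((ε₁^2 + ε₂^2)*v - 2*ε₁*ε₂*u) / (ε₁^2 - ε₂^2)] v := by
  set a := ε₁^2 + ε₂^2 with ha
  set d := ε₁^2 - ε₂^2 with hd
  clear_value a d
  rw [hasDerivAt_pi]
  intro i
  fin_cases i <;>
    simp only [ιpoly, ← ha, ← hd, Fin.zero_eta, Fin.mk_one, Fin.reduceFinMk, Matrix.cons_val]
  · refine hasDerivAt_of_eq_cubic (-(2*ε₁*ε₂*u^3)/(3*d^2) - (1/2)*ε₁*ε₂*u) (a*u^2/d^2 + (1/4)*a)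
      (-(2*ε₁*ε₂*u)/d^2) (a/(3*d^2)) ?_ ?_ <;> intros <;> ring
  · refine hasDerivAt_of_eq_cubic (-(2*ε₁*ε₂*u^3)/(3*d^2) + (1/2)*ε₁*ε₂*u) (a*u^2/d^2 - (1/4)*a)
      (-(2*ε₁*ε₂*u)/d^2) (a/(3*d^2)) ?_ ?_ <;> intros <;> ring
  · refine hasDerivAt_of_eq_cubic (a*u^2/(2*d)) (-(2*ε₁*ε₂*u)/d) (a/(2*d)) 0 ?_ ?_ <;>
      intros <;> ring

/-- `ιpoly` pulls the Minkowski metric back to `u²(dv² − du²)`. -/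
theorem ιpoly_isometric (ε₁ ε₂ : ℝ) (hε : ε₁^2 ≠ ε₂^2) :
    ∀ u v : ℝ,
      mink (deriv (fun u => ιpoly ε₁ ε₂ u v) u) (deriv (fun u => ιpoly ε₁ ε₂ u v) u)
        = -u^2 ∧
      mink (deriv (fun v => ιpoly ε₁ ε₂ u v) v) (deriv (fun v => ιpoly ε₁ ε₂ u v) v)
        = u^2 ∧
      mink (deriv (fun u => ιpoly ε₁ ε₂ u v) u) (deriv (fun v => ιpoly ε₁ ε₂ u v) v)
        = 0 := by
  intro u v
  have hd : ε₁^2 - ε₂^2 ≠ 0 := sub_ne_zero.mpr hε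
  rw [(hasDerivAt_ιpoly_left ε₁ ε₂ u v).deriv, (hasDerivAt_ιpoly_right ε₁ ε₂ u v).deriv]
  simp only [mink, Matrix.cons_val]
  refine ⟨?_, ?_, ?_⟩ <;> field_simp <;> ring
end

section
/- Define ι : ℝ² → ℝ³ by ι(u,v) = (x₁, x₂, x₃) where x₁ = (108u + 135v + 16u³ + 60u²v + 48uv² + 20v³)/108, x₂ = (108u + 135v − 16u³ − 60u²v − 48uv² − 20v³)/108, x₃ = (5u² + 8uv + 5v²)/6. Then, with the Minkowski pairing ⟨x,y⟩ = x₁y₁ − x₂y₂ − x₃y₃ on ℝ³, for all (u,v) ∈ ℝ²: ⟨∂ι/∂u, ∂ι/∂u⟩ = −u², ⟨∂ι/∂v, ∂ι/∂v⟩ = u², and ⟨∂ι/∂u, ∂ι/∂v⟩ = 0. -/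
/-- The explicit solution of the geometric Cauchy problem in the paper's worked
example. -/
noncomputable def ιex (u v : ℝ) : Fin 3 → ℝ :=
  ![(108*u + 135*v + 16*u^3 + 60*u^2*v + 48*u*v^2 + 20*v^3) / 108,
    (108*u + 135*v - 16*u^3 - 60*u^2*v - 48*u*v^2 - 20*v^3) / 108,
    (5*u^2 + 8*u*v + 5*v^2) / 6]

theorem hasDerivAt_ιex_left (u v : ℝ) :
    HasDerivAt (fun u => ιex u v)
      ![(108 + 48*u^2 + 120*u*v + 48*v^2) / 108,
        (108 - 48*u^2 - 120*u*v - 48*v^2) / 108,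
        (10*u + 8*v) / 6] u := by
  have h₁ := hasDerivAt_id' u
  have h₂ := hasDerivAt_pow 2 u
  have h₃ := hasDerivAt_pow 3 u
  have hA := (h₁.const_mul 108).add_const (135*v)
  have hB := (((h₃.const_mul 16).add ((h₂.const_mul 60).mul_const v)).add
    ((h₁.const_mul 48).mul_const (v^2))).add_const (20*v^3)
  have hC := ((h₂.const_mul 5).add ((h₁.const_mul 8).mul_const v)).add_const (5*v^2)
  rw [hasDerivAt_pi]
  intro i
  fin_cases i
  · refine ((hA.add hB).div_const 108).congr_deriv ?_ |>.congr_of_eventuallyEq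
      (.of_forall fun x => ?_) <;> simp [ιex] <;> ring
  · refine ((hA.sub hB).div_const 108).congr_deriv ?_ |>.congr_of_eventuallyEq
      (.of_forall fun x => ?_) <;> simp [ιex] <;> ring
  · refine (hC.div_const 6).congr_deriv ?_ |>.congr_of_eventuallyEq
      (.of_forall fun x => ?_) <;> simp [ιex] <;> ring

theorem hasDerivAt_ιex_right (u v : ℝ) :
    HasDerivAt (fun v => ιex u v)
      ![(135 + 60*u^2 + 96*u*v + 60*v^2) / 108,
        (135 - 60*u^2 - 96*u*v - 60*v^2) / 108,
        (8*u + 10*v) / 6] v := by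
  have h₁ := hasDerivAt_id' v
  have h₂ := hasDerivAt_pow 2 v
  have h₃ := hasDerivAt_pow 3 v
  have hA := (h₁.const_mul 135).const_add (108*u)
  have hB := (((h₁.const_mul (60*u^2)).const_add (16*u^3)).add
    (h₂.const_mul (48*u))).add (h₃.const_mul 20)
  have hC := ((h₁.const_mul (8*u)).const_add (5*u^2)).add (h₂.const_mul 5)
  rw [hasDerivAt_pi]
  intro i
  fin_cases i
  · refine ((hA.add hB).div_const 108).congr_deriv ?_ |>.congr_of_eventuallyEq
      (.of_forall fun x => ?_) <;> simp [ιex] <;> ring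
  · refine ((hA.sub hB).div_const 108).congr_deriv ?_ |>.congr_of_eventuallyEq
      (.of_forall fun x => ?_) <;> simp [ιex] <;> ring
  · refine (hC.div_const 6).congr_deriv ?_ |>.congr_of_eventuallyEq
      (.of_forall fun x => ?_) <;> simp [ιex] <;> ring

/-- `ιex` pulls the Minkowski metric `dx₁² − dx₂² − dx₃²` back to `u²(dv² − du²)`. -/
theorem ιex_isometric :
    ∀ u v : ℝ,
      mink (deriv (fun u => ιex u v) u) (deriv (fun u => ιex u v) u) = -u^2 ∧
      mink (deriv (fun v => ιex u v) v) (deriv (fun v => ιex u v) v) = u^2 ∧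
      mink (deriv (fun u => ιex u v) u) (deriv (fun v => ιex u v) v) = 0 := by
  intro u v
  rw [(hasDerivAt_ιex_left u v).deriv, (hasDerivAt_ιex_right u v).deriv]
  refine ⟨?_, ?_, ?_⟩ <;> simp [mink] <;> ring
end
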